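/- arXiv:1909.05609 — 6 statements merged into one kernel-verified Lean document; each statement's English description precedes it below -/
import Mathlib

section
/- Let n ≥ 2 and let K_{1,n-1} be the star on n vertices. Then the eccentricity matrix of K_{1,n-1} coincides with its distance matrix, and det(ε(K_{1,n-1})) = (-1)^{n-1}(n-1)·2^{n-2}; in particular, ε(K_{1,n-1}) is invertible. -/
open Finset SimpleGraph

variable {V : Type*}

/-- The eccentricity of a vertex: the largest distance to another vertex. -/
noncomputable def ecc [Fintype V] (G : SimpleGraph V) (u : V) : ℕ :=
  Finset.univ.sup fun v => G.dist u v

/-- The diameter of a graph: the largest eccentricity. -/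
noncomputable def gdiam [Fintype V] (G : SimpleGraph V) : ℕ :=
  Finset.univ.sup fun u => ecc G u

/-- The eccentricity matrix: keep the distance `d(u,v)` if it equals
`min (e u) (e v)`, and put `0` otherwise. -/
noncomputable def eccMatrix [Fintype V] (G : SimpleGraph V) : Matrix V V ℝ :=
  Matrix.of fun u v =>
    if G.dist u v = min (ecc G u) (ecc G v) then (G.dist u v : ℝ) else 0

/-- The distance matrix of a graph. -/
noncomputable def distMatrix [Fintype V] (G : SimpleGraph V) : Matrix V V ℝ :=
  Matrix.of fun u v => (G.dist u v : ℝ)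

section Star

variable {α β : Type*}

lemma dist_inl_inr (a : α) (b : β) :
    (completeBipartiteGraph α β).dist (Sum.inl a) (Sum.inr b) = 1 :=
  dist_eq_one_iff_adj.2 (by simp)

lemma dist_inr_inr [Nonempty α] {b c : β} (h : b ≠ c) :
    (completeBipartiteGraph α β).dist (Sum.inr b) (Sum.inr c) = 2 := by
  obtain ⟨a⟩ := ‹Nonempty α›
  have hba : (completeBipartiteGraph α β).Adj (Sum.inr b) (Sum.inl a) := by simp
  have hac : (completeBipartiteGraph α β).Adj (Sum.inl a) (Sum.inr c) := by simp
  let w : (completeBipartiteGraph α β).Walk (Sum.inr b) (Sum.inr c) := .cons hba (.cons hac .nil)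
  have hle : (completeBipartiteGraph α β).dist (Sum.inr b) (Sum.inr c) ≤ 2 := dist_le w
  have hpos := w.reachable.pos_dist_of_ne (by simpa using h)
  have hne : (completeBipartiteGraph α β).dist (Sum.inr b) (Sum.inr c) ≠ 1 := by
    simp [dist_eq_one_iff_adj]
  lia

lemma dist_le_ecc [Fintype V] (G : SimpleGraph V) (u v : V) : G.dist u v ≤ ecc G u :=
  Finset.le_sup (f := fun v => G.dist u v) (Finset.mem_univ v)

lemma ecc_inl_le_one [Unique α] [Fintype α] [Fintype β] (a : α) :
    ecc (completeBipartiteGraph α β) (Sum.inl a) ≤ 1 := by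
  refine Finset.sup_le fun v _ => ?_
  rcases v with b | b
  · simp [Subsingleton.elim b a]
  · exact (dist_inl_inr a b).le

lemma ecc_inr_le_two [Unique α] [Fintype α] [Fintype β] (b : β) :
    ecc (completeBipartiteGraph α β) (Sum.inr b) ≤ 2 := by
  refine Finset.sup_le fun v _ => ?_
  rcases v with a | c
  · simp [dist_comm, dist_inl_inr]
  · by_cases h : b = c
    · simp [h]
    · exact (dist_inr_inr h).le

/-- If every pair of distinct vertices realizes one of the two eccentricities, the eccentricity
matrix is the distance matrix. -/
lemma eccMatrix_eq_distMatrix [Fintype V] (G : SimpleGraph V)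
    (h : ∀ u v, u ≠ v → min (ecc G u) (ecc G v) ≤ G.dist u v) : eccMatrix G = distMatrix G := by
  ext u v
  by_cases huv : u = v
  · simp [eccMatrix, distMatrix, huv]
  · have hv := dist_le_ecc G v u
    rw [dist_comm] at hv
    simp [eccMatrix, distMatrix,
      (le_min (dist_le_ecc G u v) hv).antisymm (h u v huv)]

lemma eccMatrix_star [Unique α] [Fintype α] [Fintype β] :
    eccMatrix (completeBipartiteGraph α β) = distMatrix (completeBipartiteGraph α β) := by
  refine eccMatrix_eq_distMatrix _ fun u v huv => ?_
  rcases u with a | b <;> rcases v with c | d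
  · exact absurd (congrArg Sum.inl (Subsingleton.elim a c)) huv
  · exact (min_le_left _ _).trans ((ecc_inl_le_one a).trans (dist_inl_inr a d).ge)
  · rw [dist_comm]
    exact (min_le_right _ _).trans ((ecc_inl_le_one c).trans (dist_inl_inr c b).ge)
  · exact (min_le_left _ _).trans
      ((ecc_inr_le_two b).trans (dist_inr_inr (by simpa using huv)).ge)

lemma distMatrix_star [Unique α] [Fintype α] [Fintype β] [DecidableEq β] :
    distMatrix (completeBipartiteGraph α β) =
      Matrix.fromBlocks 0 (Matrix.of fun _ _ => 1) (Matrix.of fun _ _ => 1)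
        (Matrix.of fun i j => if i = j then 0 else 2) := by
  ext u v
  rcases u with a | b <;> rcases v with c | d
  · simp [distMatrix, Subsingleton.elim a c]
  · simp [distMatrix, dist_inl_inr]
  · simp [distMatrix, dist_comm, dist_inl_inr]
  · by_cases h : b = d
    · simp [distMatrix, h]
    · simp [distMatrix, h, dist_inr_inr h]

/-- The determinant of the distance matrix of a star with leaf set `β`: subtracting twice the
central row from every other row leaves `-2` times the identity in the block of leaves. -/
lemma det_distMatrix_star [Unique α] [Fintype α] [DecidableEq α] [Fintype β] [DecidableEq β] :
    (distMatrix (completeBipartiteGraph α β)).det =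
      (-2) ^ Fintype.card β * (Fintype.card β / 2) := by
  let L : Matrix (α ⊕ β) (α ⊕ β) ℝ := Matrix.fromBlocks 1 0 (Matrix.of fun _ _ => -2) 1
  let R : Matrix α β ℝ := Matrix.of fun _ _ => 1
  let C : Matrix β α ℝ := Matrix.of fun _ _ => 1
  have hL : L.det = 1 := by simp [L]
  have hmul : L * distMatrix (completeBipartiteGraph α β) =
      Matrix.fromBlocks 0 R C ((-2 : ℝ) • (1 : Matrix β β ℝ)) := by
    rw [distMatrix_star, Matrix.fromBlocks_multiply]
    congr 1
    · simp
    · simp [R]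
    · simp [C]
    · ext i j
      by_cases h : i = j <;> simp [Matrix.mul_apply, h]
  let : Invertible ((-2 : ℝ) • (1 : Matrix β β ℝ)) :=
    ⟨(-(1 / 2) : ℝ) • 1, by simp [smul_smul], by simp [smul_smul]⟩
  have hinv : ⅟((-2 : ℝ) • (1 : Matrix β β ℝ)) = (-(1 / 2) : ℝ) • 1 := rfl
  rw [← one_mul (Matrix.det _), ← hL, ← Matrix.det_mul, hmul, Matrix.det_fromBlocks₂₂, hinv,
    Matrix.det_smul, Matrix.det_one, mul_one]
  simp [Matrix.det_unique, Matrix.mul_apply, R, C, div_eq_mul_inv]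

end Star

/-- For `n ≥ 2`, the eccentricity matrix of the star `K_{1,n-1}` coincides
with its distance matrix, its determinant is `(-1)^(n-1) (n-1) 2^(n-2)`, and in
particular it is invertible. -/
theorem star_eccMatrix_eq_distMatrix_and_det (n : ℕ) (hn : 2 ≤ n) :
    eccMatrix (completeBipartiteGraph (Fin 1) (Fin (n - 1))) =
      distMatrix (completeBipartiteGraph (Fin 1) (Fin (n - 1))) ∧
    (eccMatrix (completeBipartiteGraph (Fin 1) (Fin (n - 1)))).det =
      (-1 : ℝ) ^ (n - 1) * (n - 1 : ℕ) * 2 ^ (n - 2) ∧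
    IsUnit (eccMatrix (completeBipartiteGraph (Fin 1) (Fin (n - 1)))).det := by
  have hdet : (eccMatrix (completeBipartiteGraph (Fin 1) (Fin (n - 1)))).det =
      (-1 : ℝ) ^ (n - 1) * (n - 1 : ℕ) * 2 ^ (n - 2) := by
    rw [eccMatrix_star, det_distMatrix_star, Fintype.card_fin]
    obtain ⟨k, rfl⟩ := Nat.exists_eq_add_of_le' hn
    simp only [Nat.add_sub_cancel, show k + 2 - 1 = k + 1 by lia]
    rw [show (-2 : ℝ) = -1 * 2 by norm_num, mul_pow, pow_succ 2 k]
    ring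
  refine ⟨eccMatrix_star, hdet, ?_⟩
  rw [hdet, isUnit_iff_ne_zero]
  have : n - 1 ≠ 0 := by lia
  simp [this]
end

section
/- Let G be a connected graph with diameter d ≥ 2. Then the ε-spectral radius satisfies ρ(ε(G)) ≥ d. -/
open Finset SimpleGraph

variable {V : Type*}

theorem Matrix.IsHermitian.posSemidef_smul_one_sub [Fintype V] [DecidableEq V]
    {A : Matrix V V ℝ} (hA : A.IsHermitian) {M : ℝ} (hM : ∀ i, hA.eigenvalues i ≤ M) :
    (M • (1 : Matrix V V ℝ) - A).PosSemidef := by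
  let U : Matrix V V ℝ := hA.eigenvectorUnitary
  have hU : U * U.conjTranspose = 1 := by
    simpa [U, Matrix.star_eq_conjTranspose] using Unitary.coe_mul_star_self hA.eigenvectorUnitary
  have hA' : A = U * Matrix.diagonal hA.eigenvalues * U.conjTranspose := by
    have h := hA.spectral_theorem
    rw [Unitary.conjStarAlgAut_apply] at h
    simpa [U, Matrix.star_eq_conjTranspose, Function.comp_def] using h
  have hD : (Matrix.diagonal fun i => M - hA.eigenvalues i).PosSemidef :=
    Matrix.posSemidef_diagonal_iff.2 fun i => sub_nonneg.2 (hM i)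
  have h := hD.mul_mul_conjTranspose_same U
  have he : (Matrix.diagonal fun i => M - hA.eigenvalues i)
      = M • (1 : Matrix V V ℝ) - Matrix.diagonal hA.eigenvalues := by
    rw [Matrix.smul_one_eq_diagonal, Matrix.diagonal_sub]
  rwa [he, mul_sub, sub_mul, ← hA', Matrix.mul_smul, mul_one, Matrix.smul_mul, hU] at h

/-- If the diagonal of a real symmetric matrix is zero at `u` and `v`, its entry at `(u, v)` is at
most any upper bound of its eigenvalues. -/
theorem Matrix.IsHermitian.apply_le_of_eigenvalues_le [Fintype V] [DecidableEq V]
    {A : Matrix V V ℝ} (hA : A.IsHermitian) {M : ℝ} (hM : ∀ i, hA.eigenvalues i ≤ M)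
    {u v : V} (huv : u ≠ v) (hu : A u u = 0) (hv : A v v = 0) : A u v ≤ M := by
  have h := (hA.posSemidef_smul_one_sub hM).dotProduct_mulVec_nonneg
    (Pi.single u 1 + Pi.single v 1)
  have hs : A v u = A u v := by simpa using hA.apply u v
  simp [Matrix.mulVec_add, add_dotProduct, dotProduct_add, hu, hv, hs, huv, huv.symm] at h
  linarith

theorem exists_dist_eq_gdiam [Fintype V] [Nonempty V] (G : SimpleGraph V) :
    ∃ u v, G.dist u v = gdiam G ∧ ecc G u = gdiam G ∧ ecc G v = gdiam G := by
  obtain ⟨u, -, hu⟩ := Finset.exists_mem_eq_sup univ univ_nonempty fun u => ecc G u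
  obtain ⟨v, -, hv⟩ := Finset.exists_mem_eq_sup univ univ_nonempty fun v => G.dist u v
  have hu' : ecc G u = gdiam G := hu.symm
  have hv' : G.dist u v = gdiam G := hv.symm.trans hu'
  refine ⟨u, v, hv', hu', le_antisymm ?_ ?_⟩
  · exact Finset.le_sup (f := fun u => ecc G u) (mem_univ v)
  · rw [← hv', SimpleGraph.dist_comm]
    exact Finset.le_sup (f := fun w => G.dist v w) (mem_univ u)

/-- A connected graph with diameter `d ≥ 2` has ε-spectral radius at
least `d`. -/
theorem eccMatrix_spectralRadius_ge_diam [Fintype V] [DecidableEq V]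
    (G : SimpleGraph V) (hG : G.Connected) (d : ℕ) (hd : gdiam G = d) (h2 : 2 ≤ d)
    (hE : (eccMatrix G).IsHermitian) :
    (d : ℝ) ≤ ⨆ i, hE.eigenvalues i := by
  have := hG.nonempty
  obtain ⟨u, v, huv, hu, hv⟩ := exists_dist_eq_gdiam G
  have hne : u ≠ v := by
    rintro rfl
    rw [SimpleGraph.dist_self] at huv
    omega
  have hM : ∀ i, hE.eigenvalues i ≤ ⨆ i, hE.eigenvalues i :=
    le_ciSup (Set.finite_range _).bddAbove
  have h := hE.apply_le_of_eigenvalues_le hM hne (by simp [eccMatrix]) (by simp [eccMatrix])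
  simpa [eccMatrix, huv, hu, hv, hd] using h
end

section
/- Let G be a diametrical graph with diameter d and 2k vertices. Then the eigenvalues of the eccentricity matrix ε(G) are d with multiplicity k and -d with multiplicity k; in particular, ρ(ε(G)) = d. -/
open Finset SimpleGraph

variable {V : Type*}

theorem eccMatrix_apply_of_ecc_eq [Fintype V] {G : SimpleGraph V} {d : ℕ}
    (h : ∀ u, ecc G u = d) (u v : V) :
    eccMatrix G u v = if G.dist u v = d then (d : ℝ) else 0 := by
  simp only [eccMatrix, Matrix.of_apply, h, min_self]
  split_ifs with huv <;> simp [huv]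

theorem eccMatrix_mul_self_of_diametrical [Fintype V] [DecidableEq V] {G : SimpleGraph V} {d : ℕ}
    (h : ∀ u : V, ecc G u = d ∧ ∃! v : V, G.dist u v = d) :
    eccMatrix G * eccMatrix G = ((d : ℝ) ^ 2) • (1 : Matrix V V ℝ) := by
  ext u w
  obtain ⟨v, hv, huniq⟩ := (h u).2
  have hA := eccMatrix_apply_of_ecc_eq fun u => (h u).1
  have hvw : G.dist v w = d ↔ u = w := by
    refine ⟨fun hw => (h v).2.unique (by rw [dist_comm]; exact hv) hw, ?_⟩
    rintro rfl
    rw [dist_comm]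
    exact hv
  rw [Matrix.mul_apply, Finset.sum_eq_single v]
  · simp only [hA, hv, hvw, Matrix.smul_apply, Matrix.one_apply, if_true]
    split_ifs <;> simp [sq]
  · intro x _ hx
    have hux : G.dist u x ≠ d := fun hd => hx (huniq x hd)
    simp [hA, hux]
  · simp

theorem trace_eccMatrix [Fintype V] (G : SimpleGraph V) : (eccMatrix G).trace = 0 := by
  simp [Matrix.trace, eccMatrix]

theorem Matrix.IsHermitian.eigenvalues_sq_of_mul_self [Fintype V] [DecidableEq V]
    {A : Matrix V V ℝ} (hA : A.IsHermitian) {c : ℝ} (h : A * A = c • (1 : Matrix V V ℝ)) (i : V) :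
    hA.eigenvalues i ^ 2 = c := by
  have hv := hA.mulVec_eigenvectorBasis i
  set x : V → ℝ := (hA.eigenvectorBasis i).ofLp with hx
  have hx0 : x ≠ 0 := fun h0 =>
    hA.eigenvectorBasis.orthonormal.ne_zero i (by ext j; exact congrFun h0 j)
  have h2 : (A * A).mulVec x = (hA.eigenvalues i ^ 2) • x := by
    rw [← Matrix.mulVec_mulVec, hv, Matrix.mulVec_smul, hv, smul_smul, sq]
  rw [h, Matrix.smul_mulVec, Matrix.one_mulVec] at h2
  exact (smul_left_injective ℝ hx0 h2).symm

theorem Finset.map_val_eq_replicate_of_sum_eq_zero [Fintype V] {f : V → ℝ} {d : ℝ} {k : ℕ}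
    (hd : 0 < d) (hf : ∀ i, f i = d ∨ f i = -d) (hsum : ∑ i, f i = 0)
    (hcard : Fintype.card V = 2 * k) :
    Finset.univ.val.map f = Multiset.replicate k d + Multiset.replicate k (-d) := by
  classical
  set s : Multiset V := Finset.univ.val with hs
  have hp : (s.filter fun i => f i = d).map f =
      Multiset.replicate (s.filter fun i => f i = d).card d := by
    rw [Multiset.eq_replicate]
    simp +contextual
  have hn : (s.filter fun i => ¬ f i = d).map f =
      Multiset.replicate (s.filter fun i => ¬ f i = d).card (-d) := by
    rw [Multiset.eq_replicate]
    refine ⟨by simp, fun b hb => ?_⟩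
    obtain ⟨i, hi, rfl⟩ := Multiset.mem_map.1 hb
    exact (hf i).resolve_left (Multiset.mem_filter.1 hi).2
  have hsplit := Multiset.filter_add_not (fun i => f i = d) s
  have hmap : s.map f = Multiset.replicate (s.filter fun i => f i = d).card d +
      Multiset.replicate (s.filter fun i => ¬ f i = d).card (-d) := by
    rw [← hp, ← hn, ← Multiset.map_add, hsplit]
  have htot : (s.filter fun i => f i = d).card + (s.filter fun i => ¬ f i = d).card = 2 * k := by
    rw [← Multiset.card_add, hsplit, ← hcard]
    rfl
  have hsum' : (s.map f).sum = 0 := hsum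
  rw [hmap] at hsum' ⊢
  generalize (s.filter fun i => f i = d).card = a at *
  generalize (s.filter fun i => ¬ f i = d).card = b at *
  simp only [Multiset.sum_add, Multiset.sum_replicate, nsmul_eq_mul] at hsum'
  have hab : (a : ℝ) = b := mul_right_cancel₀ hd.ne' (by linarith)
  have hab : a = b := by exact_mod_cast hab
  obtain rfl : a = k := by omega
  rw [← hab]

/-- A diametrical graph with diameter `d` on `2k` vertices has
ε-eigenvalues `d` with multiplicity `k` and `-d` with multiplicity `k`; in
particular its ε-spectral radius is `d`. -/
theorem eccMatrix_eigenvalues_of_diametrical [Fintype V] [DecidableEq V]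
    (G : SimpleGraph V) (hG : G.Connected) (d k : ℕ)
    (hd : gdiam G = d) (hcard : Fintype.card V = 2 * k)
    (hdiametrical : ∀ u : V, ecc G u = d ∧ ∃! v : V, G.dist u v = d)
    (hE : (eccMatrix G).IsHermitian) :
    Finset.univ.val.map hE.eigenvalues =
      Multiset.replicate k (d : ℝ) + Multiset.replicate k (-(d : ℝ)) ∧
    (⨆ i, hE.eigenvalues i) = (d : ℝ) := by
  have := hG.nonempty
  obtain ⟨u⟩ := hG.nonempty
  have hk : 0 < k := by
    have : 0 < Fintype.card V := Fintype.card_pos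
    omega
  have hd0 : 0 < d := by
    rcases Nat.eq_zero_or_pos d with rfl | h
    · have hle : ∀ v, G.dist u v = 0 := fun v => Nat.le_zero.1 <|
        (Finset.le_sup (f := fun v => G.dist u v) (Finset.mem_univ v)).trans (hdiametrical u).1.le
      have : Fintype.card V = 1 :=
        Fintype.card_eq_one_iff.2 ⟨u, fun v => (hG.dist_eq_zero_iff.1 (hle v)).symm⟩
      omega
    · exact h
  have hd0' : (0 : ℝ) < d := by exact_mod_cast hd0
  have hev : ∀ i, hE.eigenvalues i = d ∨ hE.eigenvalues i = -d := fun i =>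
    sq_eq_sq_iff_eq_or_eq_neg.1
      (hE.eigenvalues_sq_of_mul_self (eccMatrix_mul_self_of_diametrical hdiametrical) i)
  have hsum : ∑ i, hE.eigenvalues i = 0 := by
    simpa [trace_eccMatrix] using hE.trace_eq_sum_eigenvalues.symm
  have hmap := Finset.map_val_eq_replicate_of_sum_eq_zero hd0' hev hsum hcard
  refine ⟨hmap, ?_⟩
  have hmem : (d : ℝ) ∈ Finset.univ.val.map hE.eigenvalues := by
    rw [hmap]
    exact Multiset.mem_add.2 (Or.inl (Multiset.mem_replicate.2 ⟨hk.ne', rfl⟩))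
  obtain ⟨i, -, hi⟩ := Multiset.mem_map.1 hmem
  have hle : ∀ j, hE.eigenvalues j ≤ d := fun j => by
    rcases hev j with h | h <;> linarith
  exact le_antisymm (ciSup_le hle)
    (hi ▸ le_ciSup (Set.finite_range hE.eigenvalues).bddAbove i)
end

section
/- Let G be a connected graph on n ≥ 2 vertices with ε-Wiener index W_ε and ε-degrees ε(1), ε(2), …, ε(n). Then ρ(ε(G)) ≥ max_i (1/(n-1))·[(W_ε - ε(i)) + √((W_ε - ε(i))² + (n-1)·ε(i)²)]. -/
open Finset SimpleGraph

variable {V : Type*}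

/-- The Rayleigh quotient of a real symmetric matrix is at most its largest eigenvalue. -/
theorem Matrix.IsHermitian.dotProduct_mulVec_le_iSup_eigenvalues {ι : Type*} [Fintype ι]
    [DecidableEq ι] {A : Matrix ι ι ℝ} (hA : A.IsHermitian) (x : ι → ℝ) :
    x ⬝ᵥ A.mulVec x ≤ (⨆ i, hA.eigenvalues i) * (x ⬝ᵥ x) := by
  set μ := ⨆ i, hA.eigenvalues i
  have hpsd : (algebraMap ℝ (Matrix ι ι ℝ) μ - A).PosSemidef := by
    rw [Matrix.posSemidef_iff_isHermitian_and_spectrum_nonneg]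
    constructor
    · refine Matrix.IsHermitian.sub ?_ hA
      simp [Matrix.IsHermitian, Matrix.algebraMap_eq_diagonal]
    · rw [← spectrum.singleton_sub_eq, hA.spectrum_real_eq_range_eigenvalues]
      rintro _ ⟨_, rfl, _, ⟨i, rfl⟩, rfl⟩
      exact sub_nonneg.2 (le_ciSup (Set.finite_range hA.eigenvalues).bddAbove i)
  have h := hpsd.dotProduct_mulVec_nonneg x
  rw [Algebra.algebraMap_eq_smul_one, Matrix.sub_mulVec, Matrix.smul_mulVec, Matrix.one_mulVec,
    star_trivial, dotProduct_sub, dotProduct_smul, smul_eq_mul] at h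
  linarith

/-- The quadratic form of a symmetric matrix with zero diagonal at a vector equal to `a` at `i`
and to `b` elsewhere. -/
theorem Matrix.IsSymm.dotProduct_mulVec_update_const {ι : Type*} [Fintype ι] [DecidableEq ι]
    {A : Matrix ι ι ℝ} (hA : A.IsSymm) {i : ι} (hi : A i i = 0) (a b : ℝ) :
    Function.update (fun _ => b) i a ⬝ᵥ A.mulVec (Function.update (fun _ => b) i a) =
      2 * a * b * (∑ v, A i v) +
        2 * b ^ 2 * ((∑ u, ∑ v, A u v) / 2 - ∑ v, A i v) := by
  have hx : Function.update (fun _ => b) i a = (fun _ : ι => b) + Pi.single i (a - b) := by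
    ext j
    by_cases h : j = i
    · subst h; simp
    · simp [h]
  have hcol : ∑ u, A u i = ∑ v, A i v := Finset.sum_congr rfl fun u _ => hA.apply i u
  have hrow : A.mulVec (fun _ => b) = fun u => b * ∑ v, A u v := by
    ext u
    simp [Matrix.mulVec, dotProduct, Finset.mul_sum, mul_comm]
  have hconst : (fun _ : ι => b) ⬝ᵥ A.col i = b * ∑ v, A i v := by
    simp [dotProduct, ← Finset.mul_sum, hcol]
  have htotal : (fun _ : ι => b) ⬝ᵥ (fun u => b * ∑ v, A u v) = b ^ 2 * ∑ u, ∑ v, A u v := by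
    simp only [dotProduct, ← Finset.mul_sum]
    ring
  rw [hx, Matrix.mulVec_add, Matrix.mulVec_single, hrow, add_dotProduct, dotProduct_add,
    dotProduct_add, single_dotProduct, single_dotProduct, op_smul_eq_smul, dotProduct_smul,
    hconst, htotal]
  simp only [Pi.smul_apply, Matrix.col_apply, hi, smul_eq_mul]
  ring

/-- The squared norm of a vector equal to `a` at `i` and to `b` elsewhere. -/
theorem dotProduct_self_update_const {ι : Type*} [Fintype ι] [DecidableEq ι] (i : ι) (a b : ℝ) :
    Function.update (fun _ => b) i a ⬝ᵥ Function.update (fun _ => b) i a =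
      a ^ 2 + ((Fintype.card ι : ℝ) - 1) * b ^ 2 := by
  rw [dotProduct, ← Finset.add_sum_erase _ _ (Finset.mem_univ i),
    Finset.sum_congr rfl (g := fun _ => b ^ 2) fun j hj => by
      rw [Function.update_of_ne (Finset.ne_of_mem_erase hj), sq]]
  simp [Finset.card_erase_of_mem, Nat.cast_sub (Fintype.card_pos_iff.2 ⟨i⟩), sq]

/-- For a connected graph on `n ≥ 2` vertices with ε-Wiener index
`W_ε` and ε-degrees `ε(i)` (the row sums of the eccentricity matrix),
`ρ(ε(G)) ≥ max_i (1/(n-1))·((W_ε - ε(i)) + √((W_ε - ε(i))² + (n-1)·ε(i)²))`. -/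
theorem eccMatrix_spectralRadius_ge_wiener_degree [Fintype V] [DecidableEq V] [Nonempty V]
    (G : SimpleGraph V) (hG : G.Connected) (n : ℕ) (hn : Fintype.card V = n)
    (h2 : 2 ≤ n) (hE : (eccMatrix G).IsHermitian) :
    Finset.univ.sup' Finset.univ_nonempty (fun i : V =>
      (1 / ((n : ℝ) - 1)) *
        (((∑ u, ∑ v, eccMatrix G u v) / 2 - ∑ v, eccMatrix G i v) +
          Real.sqrt (((∑ u, ∑ v, eccMatrix G u v) / 2 - ∑ v, eccMatrix G i v) ^ 2 +
            ((n : ℝ) - 1) * (∑ v, eccMatrix G i v) ^ 2))) ≤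
      ⨆ i, hE.eigenvalues i := by
  have hcard : (0 : ℝ) < n - 1 := by
    have : (2 : ℝ) ≤ n := by exact_mod_cast h2
    linarith
  refine Finset.sup'_le _ _ fun i _ => ?_
  have hdiag : eccMatrix G i i = 0 := by simp [eccMatrix]
  have hsymm : (eccMatrix G).IsSymm := by
    simpa [Matrix.IsHermitian, Matrix.IsSymm] using hE
  have hray : ∀ a b : ℝ, _ := fun a b =>
    hE.dotProduct_mulVec_le_iSup_eigenvalues (Function.update (fun _ => b) i a)
  simp only [hsymm.dotProduct_mulVec_update_const hdiag, dotProduct_self_update_const, hn] at hray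
  set μ := ⨆ i, hE.eigenvalues i
  set d := ∑ v, eccMatrix G i v
  set S := (∑ u, ∑ v, eccMatrix G u v) / 2 - d
  have hrad : 0 ≤ S ^ 2 + ((n : ℝ) - 1) * d ^ 2 := by positivity
  set r := √(S ^ 2 + ((n : ℝ) - 1) * d ^ 2)
  have hr2 : r ^ 2 = S ^ 2 + ((n : ℝ) - 1) * d ^ 2 := Real.sq_sqrt hrad
  have hSr : 0 ≤ S + r := by
    have : |S| ≤ r := Real.abs_le_sqrt (by nlinarith [sq_nonneg d])
    linarith [neg_abs_le S]
  set θ := 1 / ((n : ℝ) - 1) * (S + r) with hθ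
  have hθr : ((n : ℝ) - 1) * θ = S + r := by rw [hθ]; field_simp
  have hθ0 : 0 ≤ θ := by positivity
  have hquad : ((n : ℝ) - 1) * θ ^ 2 = 2 * S * θ + d ^ 2 := by
    refine mul_left_cancel₀ hcard.ne' ?_
    linear_combination (((n : ℝ) - 1) * θ + (S + r) - 2 * S) * hθr + hr2
  rcases hθ0.eq_or_lt with h0 | hpos
  · rw [← h0]
    simpa using hray 1 0
  · have hnorm : 0 < d ^ 2 + ((n : ℝ) - 1) * θ ^ 2 := by positivity
    refine le_of_mul_le_mul_right ?_ hnorm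
    linear_combination hray d θ + θ * hquad
end

section
/- Let p, q ≥ 2. The ε-energy of the complete bipartite graph K_{p,q} equals 4(p+q-2). -/
open Finset SimpleGraph

variable {V : Type*}

open Matrix Polynomial in
/-- The characteristic polynomial of `c (J - I)`, where `J` is the all-ones matrix. -/
lemma charpoly_vecMulVec_const_sub_scalar {R n : Type*} [CommRing R] [Nontrivial R] [Fintype n]
    [DecidableEq n] [Nonempty n] (c : R) :
    (vecMulVec (fun _ : n => c) (fun _ : n => 1) - scalar n c).charpoly =
      (X + C c) ^ (Fintype.card n - 1) * (X - C (c * ((Fintype.card n : R) - 1))) := by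
  obtain ⟨k, hk⟩ := Nat.exists_eq_succ_of_ne_zero (Fintype.card_ne_zero (α := n))
  rw [charpoly_sub_scalar, charpoly_vecMulVec, hk]
  simp [dotProduct, hk, smul_eq_C_mul]
  ring

section CompleteBipartite

variable {α β : Type*}

lemma completeBipartiteGraph_dist_inl_inr (a : α) (b : β) :
    (completeBipartiteGraph α β).dist (.inl a) (.inr b) = 1 :=
  dist_eq_one_iff_adj.mpr (by simp)

lemma completeBipartiteGraph_dist_inr_inl (a : α) (b : β) :
    (completeBipartiteGraph α β).dist (.inr b) (.inl a) = 1 :=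
  dist_eq_one_iff_adj.mpr (by simp)

lemma completeBipartiteGraph_dist_inl_inl [DecidableEq α] [Nonempty β] (a a' : α) :
    (completeBipartiteGraph α β).dist (.inl a) (.inl a') = if a = a' then 0 else 2 := by
  split_ifs with h
  · simp [h]
  · have hc : ((completeBipartiteGraph α β).commonNeighbors (.inl a) (.inl a')).Nonempty :=
      ⟨.inr (Classical.arbitrary β), by simp [mem_commonNeighbors]⟩
    rw [SimpleGraph.dist, edist_eq_two_iff.mpr ⟨by simpa using h, by simp, hc⟩]
    rfl

lemma completeBipartiteGraph_dist_inr_inr [DecidableEq β] [Nonempty α] (b b' : β) :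
    (completeBipartiteGraph α β).dist (.inr b) (.inr b') = if b = b' then 0 else 2 := by
  split_ifs with h
  · simp [h]
  · have hc : ((completeBipartiteGraph α β).commonNeighbors (.inr b) (.inr b')).Nonempty :=
      ⟨.inl (Classical.arbitrary α), by simp [mem_commonNeighbors]⟩
    rw [SimpleGraph.dist, edist_eq_two_iff.mpr ⟨by simpa using h, by simp, hc⟩]
    rfl

variable [Fintype α] [Fintype β] [Nontrivial α] [Nontrivial β]

lemma ecc_completeBipartiteGraph (u : α ⊕ β) : ecc (completeBipartiteGraph α β) u = 2 := by
  classical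
  apply le_antisymm
  · refine Finset.sup_le fun v _ => ?_
    rcases u with a | b <;> rcases v with a' | b' <;>
      simp only [completeBipartiteGraph_dist_inl_inl, completeBipartiteGraph_dist_inl_inr,
        completeBipartiteGraph_dist_inr_inl, completeBipartiteGraph_dist_inr_inr] <;>
      grind
  · rcases u with a | b
    · obtain ⟨a', h⟩ := exists_ne a
      refine le_trans ?_ (Finset.le_sup (Finset.mem_univ (Sum.inl a')))
      simp [completeBipartiteGraph_dist_inl_inl, h.symm]
    · obtain ⟨b', h⟩ := exists_ne b
      refine le_trans ?_ (Finset.le_sup (Finset.mem_univ (Sum.inr b')))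
      simp [completeBipartiteGraph_dist_inr_inr, h.symm]

open Matrix in
lemma eccMatrix_completeBipartiteGraph [DecidableEq α] [DecidableEq β] :
    eccMatrix (completeBipartiteGraph α β) =
      fromBlocks (vecMulVec (fun _ => 2) (fun _ => 1) - scalar α 2) 0 0
        (vecMulVec (fun _ => 2) (fun _ => 1) - scalar β 2) := by
  ext u v
  rcases u with a | b <;> rcases v with a' | b'
  · by_cases h : a = a' <;>
      simp [eccMatrix, ecc_completeBipartiteGraph, completeBipartiteGraph_dist_inl_inl,
        vecMulVec_apply, h]
  · simp [eccMatrix, ecc_completeBipartiteGraph, completeBipartiteGraph_dist_inl_inr]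
  · simp [eccMatrix, ecc_completeBipartiteGraph, completeBipartiteGraph_dist_inr_inl]
  · by_cases h : b = b' <;>
      simp [eccMatrix, ecc_completeBipartiteGraph, completeBipartiteGraph_dist_inr_inr,
        vecMulVec_apply, h]

end CompleteBipartite

open Polynomial in
lemma sum_map_abs_roots_X_add_C_pow_mul (c d : ℝ) (k : ℕ) :
    (((X + C c) ^ k * (X - C d)).roots.map (|·|)).sum = k * |c| + |d| := by
  have hX : (X + C c : ℝ[X]) = X - C (-c) := by simp
  rw [hX, roots_mul (mul_ne_zero (pow_ne_zero _ (X_sub_C_ne_zero _)) (X_sub_C_ne_zero _)),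
    roots_pow, roots_X_sub_C, roots_X_sub_C]
  simp [Multiset.map_nsmul, Multiset.sum_nsmul]

lemma sum_abs_eigenvalues_eq_sum_roots_charpoly {n : Type*} [Fintype n] [DecidableEq n]
    {A : Matrix n n ℝ} (hA : A.IsHermitian) :
    ∑ i, |hA.eigenvalues i| = (A.charpoly.roots.map (|·|)).sum := by
  rw [hA.roots_charpoly_eq_eigenvalues, Multiset.map_map]
  rfl

/-- For `p, q ≥ 2`, the ε-energy (sum of the absolute values of the
eigenvalues of the eccentricity matrix) of `K_{p,q}` equals `4(p+q-2)`. -/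
theorem eccEnergy_completeBipartite (p q : ℕ) (hp : 2 ≤ p) (hq : 2 ≤ q)
    (hE : (eccMatrix (completeBipartiteGraph (Fin p) (Fin q))).IsHermitian) :
    ∑ i, |hE.eigenvalues i| = 4 * ((p : ℝ) + (q : ℝ) - 2) := by
  have : Nontrivial (Fin p) := Fin.nontrivial_iff_two_le.mpr hp
  have : Nontrivial (Fin q) := Fin.nontrivial_iff_two_le.mpr hq
  have hchar : (eccMatrix (completeBipartiteGraph (Fin p) (Fin q))).charpoly ≠ 0 :=
    (Matrix.charpoly_monic _).ne_zero
  rw [eccMatrix_completeBipartiteGraph, Matrix.charpoly_fromBlocks_zero₁₂,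
    charpoly_vecMulVec_const_sub_scalar, charpoly_vecMulVec_const_sub_scalar] at hchar
  rw [sum_abs_eigenvalues_eq_sum_roots_charpoly, eccMatrix_completeBipartiteGraph,
    Matrix.charpoly_fromBlocks_zero₁₂, charpoly_vecMulVec_const_sub_scalar,
    charpoly_vecMulVec_const_sub_scalar, Polynomial.roots_mul hchar, Multiset.map_add,
    Multiset.sum_add, sum_map_abs_roots_X_add_C_pow_mul, sum_map_abs_roots_X_add_C_pow_mul]
  have hp' : (2 : ℝ) ≤ p := by exact_mod_cast hp
  have hq' : (2 : ℝ) ≤ q := by exact_mod_cast hq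
  rw [Fintype.card_fin, Fintype.card_fin, Nat.cast_sub (by lia), Nat.cast_sub (by lia),
    abs_of_nonneg (by linarith : (0 : ℝ) ≤ 2 * (p - 1)),
    abs_of_nonneg (by linarith : (0 : ℝ) ≤ 2 * (q - 1)), abs_two, Nat.cast_one]
  ring
end

section
/- Let n ≥ 6 and let p, q be integers with 2 ≤ p, q ≤ n-2. Then the complete bipartite graphs K_{p,n-p} and K_{q,n-q} have the same ε-energy (namely 4(n-2)), i.e., they are ε-equienergetic; moreover, if {p, n-p} ≠ {q, n-q}, they are not ε-cospectral (their eccentricity matrices have different multisets of eigenvalues). -/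
open Finset SimpleGraph

variable {V : Type*}

open Polynomial in
/-- The characteristic polynomial of the matrix `2 (J - I)`. -/
lemma charpoly_two_mul_ones_sub_scalar {α : Type*} [Fintype α] [DecidableEq α] [Nonempty α] :
    (Matrix.vecMulVec (fun _ : α => (2 : ℝ)) (fun _ => 1) - Matrix.scalar α 2).charpoly =
      (X - C (2 * ((Fintype.card α : ℝ) - 1))) * (X - C (-2)) ^ (Fintype.card α - 1) := by
  obtain ⟨k, hk⟩ : ∃ k, Fintype.card α = k + 1 := Nat.exists_eq_add_one.mpr Fintype.card_pos
  rw [Matrix.charpoly_sub_scalar, Matrix.charpoly_vecMulVec]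
  simp only [hk, dotProduct, smul_eq_C_mul, sub_comp, add_comp,
    mul_comp, X_pow_comp, X_comp, C_comp, one_comp, mul_one,
    Finset.sum_const, Finset.card_univ, nsmul_eq_mul, Nat.add_sub_cancel, Nat.cast_add,
    Nat.cast_one, add_sub_cancel_right, C_mul, C_neg, C_add, map_one, pow_succ]
  ring

namespace SimpleGraph

variable {α β : Type*}

lemma completeBipartiteGraph_dist_inl_inl [DecidableEq α] [Nonempty β] (a b : α) :
    (completeBipartiteGraph α β).dist (Sum.inl a) (Sum.inl b) = if a = b then 0 else 2 := by
  split_ifs with h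
  · simp [h]
  · have : (completeBipartiteGraph α β).edist (Sum.inl a) (Sum.inl b) = 2 :=
      edist_eq_two_iff.mpr ⟨by simpa using h, by simp,
        ⟨Sum.inr (Classical.arbitrary β), by simp [mem_commonNeighbors]⟩⟩
    simp [SimpleGraph.dist, this]

lemma completeBipartiteGraph_dist_inr_inr [DecidableEq β] [Nonempty α] (a b : β) :
    (completeBipartiteGraph α β).dist (Sum.inr a) (Sum.inr b) = if a = b then 0 else 2 := by
  split_ifs with h
  · simp [h]
  · have : (completeBipartiteGraph α β).edist (Sum.inr a) (Sum.inr b) = 2 :=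
      edist_eq_two_iff.mpr ⟨by simpa using h, by simp,
        ⟨Sum.inl (Classical.arbitrary α), by simp [mem_commonNeighbors]⟩⟩
    simp [SimpleGraph.dist, this]

lemma completeBipartiteGraph_dist_inl_inr (a : α) (b : β) :
    (completeBipartiteGraph α β).dist (Sum.inl a) (Sum.inr b) = 1 :=
  dist_eq_one_iff_adj.mpr (by simp)

lemma completeBipartiteGraph_dist_inr_inl (a : β) (b : α) :
    (completeBipartiteGraph α β).dist (Sum.inr a) (Sum.inl b) = 1 :=
  dist_eq_one_iff_adj.mpr (by simp)

variable [Fintype α] [Fintype β] [DecidableEq α] [DecidableEq β] [Nontrivial α] [Nontrivial β]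

lemma ecc_completeBipartiteGraph (u : α ⊕ β) : ecc (completeBipartiteGraph α β) u = 2 := by
  apply le_antisymm
  · refine Finset.sup_le fun v _ => ?_
    rcases u with a | a <;> rcases v with b | b <;>
      simp only [completeBipartiteGraph_dist_inl_inl, completeBipartiteGraph_dist_inr_inr,
        completeBipartiteGraph_dist_inl_inr, completeBipartiteGraph_dist_inr_inl] <;>
      grind
  · rcases u with a | a
    · obtain ⟨b, hb⟩ := exists_ne a
      refine le_of_eq_of_le ?_ (Finset.le_sup (Finset.mem_univ (Sum.inl b)))
      simp [completeBipartiteGraph_dist_inl_inl, hb.symm]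
    · obtain ⟨b, hb⟩ := exists_ne a
      refine le_of_eq_of_le ?_ (Finset.le_sup (Finset.mem_univ (Sum.inr b)))
      simp [completeBipartiteGraph_dist_inr_inr, hb.symm]

lemma eccMatrix_completeBipartiteGraph :
    eccMatrix (completeBipartiteGraph α β) = Matrix.fromBlocks
      (Matrix.vecMulVec (fun _ : α => (2 : ℝ)) (fun _ => 1) - Matrix.scalar α 2) 0 0
      (Matrix.vecMulVec (fun _ : β => (2 : ℝ)) (fun _ => 1) - Matrix.scalar β 2) := by
  ext u v
  rcases u with a | a <;> rcases v with b | b <;>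
    simp only [eccMatrix, Matrix.of_apply, ecc_completeBipartiteGraph,
      completeBipartiteGraph_dist_inl_inl, completeBipartiteGraph_dist_inr_inr,
      completeBipartiteGraph_dist_inl_inr, completeBipartiteGraph_dist_inr_inl,
      Matrix.fromBlocks_apply₁₁, Matrix.fromBlocks_apply₁₂, Matrix.fromBlocks_apply₂₁,
      Matrix.fromBlocks_apply₂₂, Matrix.sub_apply, Matrix.vecMulVec_apply, Matrix.scalar_apply,
      Matrix.diagonal_apply, Matrix.zero_apply] <;>
    split_ifs <;> simp_all

lemma eigenvalues_eccMatrix_completeBipartiteGraph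
    (h : (eccMatrix (completeBipartiteGraph α β)).IsHermitian) :
    Finset.univ.val.map h.eigenvalues =
      {2 * ((Fintype.card α : ℝ) - 1), 2 * ((Fintype.card β : ℝ) - 1)} +
        Multiset.replicate (Fintype.card α + Fintype.card β - 2) (-2) := by
  have hα : 1 < Fintype.card α := Fintype.one_lt_card
  have hβ : 1 < Fintype.card β := Fintype.one_lt_card
  have hC (x : ℝ) : Polynomial.X - Polynomial.C x ≠ 0 := Polynomial.X_sub_C_ne_zero x
  refine h.roots_charpoly_eq_eigenvalues.symm.trans ?_
  rw [eccMatrix_completeBipartiteGraph, Matrix.charpoly_fromBlocks_zero₁₂,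
    charpoly_two_mul_ones_sub_scalar, charpoly_two_mul_ones_sub_scalar, Polynomial.roots_mul,
    Polynomial.roots_mul, Polynomial.roots_mul, Polynomial.roots_pow, Polynomial.roots_pow,
    Polynomial.roots_X_sub_C, Polynomial.roots_X_sub_C, Polynomial.roots_X_sub_C,
    show Fintype.card α + Fintype.card β - 2 =
      (Fintype.card α - 1) + (Fintype.card β - 1) by omega,
    Multiset.replicate_add, ← Multiset.nsmul_singleton, ← Multiset.nsmul_singleton,
    Multiset.insert_eq_cons, ← Multiset.singleton_add, add_add_add_comm]
  all_goals simp only [ne_eq, mul_eq_zero, pow_eq_zero_iff', hC, false_and, or_self,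
    not_false_eq_true]

lemma sum_abs_eigenvalues_eccMatrix_completeBipartiteGraph
    (h : (eccMatrix (completeBipartiteGraph α β)).IsHermitian) :
    ∑ i, |h.eigenvalues i| = 4 * ((Fintype.card α + Fintype.card β : ℕ) - 2 : ℝ) := by
  have hα : 1 < Fintype.card α := Fintype.one_lt_card
  have hβ : 1 < Fintype.card β := Fintype.one_lt_card
  have hsum := congrArg (fun s => (s.map (|·|)).sum)
    (eigenvalues_eccMatrix_completeBipartiteGraph h)
  simp only [Multiset.map_map, Multiset.map_add, Multiset.insert_eq_cons, Multiset.map_cons,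
    Multiset.map_singleton, Multiset.sum_add, Multiset.sum_cons, Multiset.sum_singleton,
    Multiset.map_replicate, Multiset.sum_replicate, nsmul_eq_mul, abs_neg] at hsum
  have hα' : (1 : ℝ) ≤ Fintype.card α := by exact_mod_cast hα.le
  have hβ' : (1 : ℝ) ≤ Fintype.card β := by exact_mod_cast hβ.le
  rw [abs_of_nonneg (by linarith), abs_of_nonneg (by linarith), abs_of_pos two_pos,
    Nat.cast_sub (by omega)] at hsum
  refine Eq.trans hsum ?_
  push_cast
  ring

end SimpleGraph

/-- For `n ≥ 6` and `2 ≤ p, q ≤ n-2`, the graphs `K_{p,n-p}` and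
`K_{q,n-q}` both have ε-energy `4(n-2)` (so they are ε-equienergetic), and when
`{p, n-p} ≠ {q, n-q}` they are not ε-cospectral. -/
theorem completeBipartite_equienergetic_not_cospectral (n p q : ℕ) (hn : 6 ≤ n)
    (hp2 : 2 ≤ p) (hpn : p ≤ n - 2) (hq2 : 2 ≤ q) (hqn : q ≤ n - 2)
    (hEp : (eccMatrix (completeBipartiteGraph (Fin p) (Fin (n - p)))).IsHermitian)
    (hEq : (eccMatrix (completeBipartiteGraph (Fin q) (Fin (n - q)))).IsHermitian) :
    (∑ i, |hEp.eigenvalues i| = 4 * ((n : ℝ) - 2) ∧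
      ∑ i, |hEq.eigenvalues i| = 4 * ((n : ℝ) - 2)) ∧
    (({p, n - p} : Finset ℕ) ≠ ({q, n - q} : Finset ℕ) →
      Finset.univ.val.map hEp.eigenvalues ≠ Finset.univ.val.map hEq.eigenvalues) := by
  have : Nontrivial (Fin p) := Fin.nontrivial_iff_two_le.mpr hp2
  have : Nontrivial (Fin q) := Fin.nontrivial_iff_two_le.mpr hq2
  have : Nontrivial (Fin (n - p)) := Fin.nontrivial_iff_two_le.mpr (by omega)
  have : Nontrivial (Fin (n - q)) := Fin.nontrivial_iff_two_le.mpr (by omega)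
  refine ⟨⟨?_, ?_⟩, fun hne heq => hne ?_⟩
  · have h := sum_abs_eigenvalues_eccMatrix_completeBipartiteGraph hEp
    rwa [Fintype.card_fin, Fintype.card_fin, Nat.add_sub_of_le (by omega)] at h
  · have h := sum_abs_eigenvalues_eccMatrix_completeBipartiteGraph hEq
    rwa [Fintype.card_fin, Fintype.card_fin, Nat.add_sub_of_le (by omega)] at h
  · rw [eigenvalues_eccMatrix_completeBipartiteGraph, eigenvalues_eccMatrix_completeBipartiteGraph]
      at heq
    simp only [Fintype.card_fin] at heq
    rw [Nat.add_sub_of_le (by omega), Nat.add_sub_of_le (by omega), add_left_inj] at heq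
    have hmem : 2 * ((p : ℝ) - 1) ∈
        ({2 * ((q : ℝ) - 1), 2 * (((n - q : ℕ) : ℝ) - 1)} : Multiset ℝ) := by
      rw [← heq]
      exact Multiset.mem_cons_self _ _
    have hpq : p = q ∨ p = n - q := by
      simpa using hmem
    rcases hpq with rfl | rfl
    · rfl
    · rw [Nat.sub_sub_self (by omega), Finset.pair_comm]
end
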